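/- Let p ≥ 1, let U ⊆ ℝ^p be open and connected, and let E ⊆ U be a set whose (p−1)-dimensional Hausdorff measure is zero. Then U ∖ E is connected. -/

import Mathlib

open MeasureTheory

section HausdorffNull

variable {F : Type*} [NormedAddCommGroup F] [NormedSpace ℝ F] [FiniteDimensional ℝ F]

theorem exists_surjective_linearMap_pi_apply_eq_zero {n : ℕ}
    (hn : Module.finrank ℝ F = n + 1) {d : F} (hd : d ≠ 0) :
    ∃ f : F →ₗ[ℝ] (Fin n → ℝ), Function.Surjective f ∧ f d = 0 := by
  have hq : Module.finrank ℝ (F ⧸ Submodule.span ℝ {d}) = Module.finrank ℝ (Fin n → ℝ) := by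
    have := Submodule.finrank_quotient_add_finrank (Submodule.span ℝ {d})
    rw [finrank_span_singleton hd] at this
    simp only [Module.finrank_fin_fun]
    omega
  refine ⟨(LinearEquiv.ofFinrankEq _ _ hq).toLinearMap ∘ₗ (Submodule.span ℝ {d}).mkQ,
    (LinearEquiv.surjective _).comp (Submodule.mkQ_surjective _), ?_⟩
  have : (Submodule.span ℝ {d}).mkQ d = 0 := by
    simp
  rw [LinearMap.comp_apply, this, map_zero]

variable [MeasurableSpace F] [BorelSpace F]

theorem dense_compl_of_hausdorffMeasure_eq_zero {n : ℕ} (hn : Module.finrank ℝ F = n + 1)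
    {E : Set F} (hE : μH[(n : ℝ)] E = 0) : Dense Eᶜ := by
  apply dense_compl_of_dimH_lt_finrank
  have h : dimH E ≤ ((n : NNReal) : ENNReal) :=
    dimH_le_of_hausdorffMeasure_ne_top (by simp [hE])
  refine h.trans_lt ?_
  rw [hn]
  exact_mod_cast Nat.lt_succ_self n

/-- Arbitrarily small translates of a segment avoid a set of codimension-one measure zero. -/
theorem exists_segment_add_disjoint_of_hausdorffMeasure_eq_zero {n : ℕ}
    (hn : Module.finrank ℝ F = n + 1) {E : Set F} (hE : μH[(n : ℝ)] E = 0) {x y : F}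
    (hxy : x ≠ y) {W : Set F} (hW : IsOpen W) (h0 : (0 : F) ∈ W) :
    ∃ w ∈ W, Disjoint (segment ℝ (x + w) (y + w)) E := by
  obtain ⟨f, hf, hfd⟩ := exists_surjective_linearMap_pi_apply_eq_zero hn (sub_ne_zero.2 hxy.symm)
  have hnull : volume (f '' E) = 0 := by
    have := (LinearMap.toContinuousLinearMap f).lipschitz.hausdorffMeasure_image_le
      (Nat.cast_nonneg n) E
    rw [hE, mul_zero] at this
    rw [← hausdorffMeasure_pi_real, Fintype.card_fin]
    exact le_antisymm this bot_le
  have hopen : IsOpen ((fun w => f (x + w)) '' W) := by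
    have : IsOpenMap (fun w => f (x + w)) :=
      (f.isOpenMap_of_finiteDimensional hf).comp (isOpenMap_add_left x)
    exact this W hW
  have hpos : 0 < volume ((fun w => f (x + w)) '' W) := hopen.measure_pos _ ⟨_, 0, h0, rfl⟩
  obtain ⟨_, ⟨w, hw, rfl⟩, hwE⟩ : ∃ z ∈ (fun w => f (x + w)) '' W, z ∉ f '' E := by
    by_contra! h
    exact hpos.ne' (measure_mono_null h hnull)
  refine ⟨w, hw, Set.disjoint_left.2 fun z hz hzE => hwE ⟨z, hzE, ?_⟩⟩
  rw [segment_eq_image'] at hz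
  obtain ⟨t, -, rfl⟩ := hz
  simp [hfd]

theorem Convex.isPreconnected_diff_of_hausdorffMeasure_eq_zero {n : ℕ}
    (hn : Module.finrank ℝ F = n + 1) {B E : Set F} (hB : Convex ℝ B) (hBo : IsOpen B)
    (hE : μH[(n : ℝ)] E = 0) : IsPreconnected (B \ E) := by
  rintro u v hu hv huv ⟨x, hx, hxu⟩ ⟨y, hy, hyv⟩
  obtain rfl | hxy := eq_or_ne x y
  · exact ⟨x, hx, hxu, hyv⟩
  obtain ⟨w, ⟨hwu, hwv⟩, hwE⟩ := exists_segment_add_disjoint_of_hausdorffMeasure_eq_zero hn hE hxy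
    (W := (x + ·) ⁻¹' (u ∩ B) ∩ (y + ·) ⁻¹' (v ∩ B))
    (((hu.inter hBo).preimage (by fun_prop)).inter ((hv.inter hBo).preimage (by fun_prop)))
    (by simp [hxu, hyv, hx.1, hy.1])
  have hsub : segment ℝ (x + w) (y + w) ⊆ B \ E := fun z hz =>
    ⟨hB.segment_subset hwu.2 hwv.2 hz, Set.disjoint_left.1 hwE hz⟩
  obtain ⟨z, hz, hzuv⟩ := (convex_segment (x + w) (y + w)).isPreconnected u v hu hv
    (hsub.trans huv) ⟨_, left_mem_segment ℝ _ _, hwu.1⟩ ⟨_, right_mem_segment ℝ _ _, hwv.1⟩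
  exact ⟨z, hsub hz, hzuv⟩

end HausdorffNull

/-- Removing a set with dense complement from a preconnected set preserves preconnectedness if it
does so locally. -/
theorem IsPreconnected.diff_of_local {X : Type*} [TopologicalSpace X] {U E : Set X}
    (hU : IsPreconnected U) (hUo : IsOpen U) (hE : Dense Eᶜ)
    (hloc : ∀ x ∈ U, ∃ B, IsOpen B ∧ x ∈ B ∧ B ⊆ U ∧ IsPreconnected (B \ E)) :
    IsPreconnected (U \ E) := by
  rintro u v hu hv huv ⟨a, ha, hau⟩ ⟨b, hb, hbv⟩
  by_contra hne
  have hdisj : ∀ z ∈ U \ E, z ∈ u → z ∉ v := fun z hz hzu hzv => hne ⟨z, hz, hzu, hzv⟩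
  let A (t : Set X) : Set X := ⋃₀ {B | IsOpen B ∧ B \ E ⊆ t}
  have hA (t : Set X) : IsOpen (A t) := isOpen_sUnion fun B hB => hB.1
  have hAmem {t : Set X} {z : X} (hz : z ∈ A t) (hzE : z ∉ E) : z ∈ t := by
    obtain ⟨B, hB, hzB⟩ := hz
    exact hB.2 ⟨hzB, hzE⟩
  have hcov : U ⊆ A u ∪ A v := by
    intro x hx
    obtain ⟨B, hBo, hxB, hBU, hB⟩ := hloc x hx
    have hBE : B \ E ⊆ U \ E := Set.sdiff_subset_sdiff_left hBU
    by_cases h : (B \ E ∩ v).Nonempty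
    · refine Or.inr ⟨B, ⟨hBo, fun z hz => ?_⟩, hxB⟩
      refine (huv (hBE hz)).resolve_left fun hzu => ?_
      obtain ⟨z', hz', hz'uv⟩ := hB u v hu hv (hBE.trans huv) ⟨z, hz, hzu⟩ h
      exact hne ⟨z', hBE hz', hz'uv⟩
    · exact Or.inl ⟨B, ⟨hBo, fun z hz => (huv (hBE hz)).resolve_right fun hzv => h ⟨z, hz, hzv⟩⟩,
        hxB⟩
  have haA : a ∈ A u := (hcov ha.1).resolve_right fun h => hdisj a ha hau (hAmem h ha.2)
  have hbA : b ∈ A v := (hcov hb.1).resolve_left fun h => hdisj b hb (hAmem h hb.2) hbv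
  obtain ⟨z, ⟨hzU, hzu, hzv⟩, hzE⟩ := hE.inter_open_nonempty _ (hUo.inter ((hA u).inter (hA v)))
    (hU _ _ (hA u) (hA v) hcov ⟨a, ha.1, haA⟩ ⟨b, hb.1, hbA⟩)
  exact hdisj z ⟨hzU, hzE⟩ (hAmem hzu hzE) (hAmem hzv hzE)

theorem stmt13 (p : ℕ) (hp : 1 ≤ p) (U : Set (EuclideanSpace ℝ (Fin p)))
    (hUopen : IsOpen U) (hUconn : IsConnected U) (E : Set (EuclideanSpace ℝ (Fin p)))
    (hEU : E ⊆ U) (hE : μH[((p : ℝ) - 1)] E = 0) :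
    IsConnected (U \ E) := by
  obtain ⟨n, rfl⟩ := Nat.exists_eq_add_of_le' hp
  have hn : Module.finrank ℝ (EuclideanSpace ℝ (Fin (n + 1))) = n + 1 := finrank_euclideanSpace_fin
  rw [Nat.cast_add_one, add_sub_cancel_right] at hE
  have hdense := dense_compl_of_hausdorffMeasure_eq_zero hn hE
  refine ⟨hdense.inter_open_nonempty U hUopen hUconn.nonempty,
    hUconn.isPreconnected.diff_of_local hUopen hdense fun x hx => ?_⟩
  obtain ⟨r, hr, hrU⟩ := Metric.isOpen_iff.1 hUopen x hx
  exact ⟨Metric.ball x r, Metric.isOpen_ball, Metric.mem_ball_self hr, hrU,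
    (convex_ball x r).isPreconnected_diff_of_hausdorffMeasure_eq_zero hn Metric.isOpen_ball hE⟩
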